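/- Assume the sprinkling setup. There exist constants c > 0 and δ > 0 (sufficiently small with respect to λ-1) and C > 3 such that for every ε > 0 there exists n_0 with the following property: for every n ≥ n_0 and every d-regular graph G on n vertices satisfying (P2), with probability at least 1-ε every vertex v ∈ V(G) satisfies dist_G(v, W) ≤ 2 log log n. -/

import Mathlib

open scoped Classical

/-- Number of edges of `G` with both endpoints in `U`. -/
noncomputable def edgesWithin {V : Type*} (G : SimpleGraph V) (U : Set V) : ℕ :=
  {e ∈ G.edgeSet | ∀ v ∈ e, v ∈ U}.ncard

/-- Number of edges of `G` with exactly one endpoint in `U`. -/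
noncomputable def edgesAcross {V : Type*} (G : SimpleGraph V) (U : Set V) : ℕ :=
  {e ∈ G.edgeSet | (∃ a ∈ e, a ∈ U) ∧ (∃ b ∈ e, b ∉ U)}.ncard

/-- `G` is `d`-regular. -/
def isRegular {V : Type*} (G : SimpleGraph V) (d : ℕ) : Prop :=
  ∀ v, (G.neighborSet v).ncard = d

/-- The number of vertices of the connected component of `v` in `H`. -/
noncomputable def compCard {V : Type*} (H : SimpleGraph V) (v : V) : ℕ :=
  {u | H.Reachable v u}.ncard

/-- The weight of the edge subset `S` under `p`-bond percolation on `G`. -/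
noncomputable def percWeight {V : Type*} [Fintype V] (G : SimpleGraph V) (p : ℝ)
    (S : Finset (Sym2 V)) : ℝ :=
  p ^ S.card * (1 - p) ^ (G.edgeFinset.card - S.card)

/-- The probability, under `p`-bond percolation on `G` (each edge retained independently
with probability `p`), that the retained edge set satisfies `Q`. -/
noncomputable def percProb {V : Type*} [Fintype V] (G : SimpleGraph V) (p : ℝ)
    (Q : Finset (Sym2 V) → Prop) : ℝ :=
  ∑ S ∈ G.edgeFinset.powerset, if Q S then percWeight G p S else 0

/-- The probability, under two independent bond percolations on `G` with probabilities
`p₁` and `p₂`, that the pair of retained edge sets satisfies `Q`. -/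
noncomputable def percProb2 {V : Type*} [Fintype V] (G : SimpleGraph V) (p₁ p₂ : ℝ)
    (Q : Finset (Sym2 V) → Finset (Sym2 V) → Prop) : ℝ :=
  ∑ S₁ ∈ G.edgeFinset.powerset, ∑ S₂ ∈ G.edgeFinset.powerset,
    if Q S₁ S₂ then percWeight G p₁ S₁ * percWeight G p₂ S₂ else 0

/-- The weight of `S` as a `p`-random subset of `E`. -/
noncomputable def subsetWeight {α : Type*} (p : ℝ) (E S : Finset α) : ℝ :=
  p ^ S.card * (1 - p) ^ (E.card - S.card)

theorem subsetWeight_nonneg {α : Type*} {p : ℝ} (h0 : 0 ≤ p) (h1 : p ≤ 1) (E S : Finset α) :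
    0 ≤ subsetWeight p E S :=
  mul_nonneg (pow_nonneg h0 _) (pow_nonneg (by linarith) _)

theorem sum_subsetWeight {α : Type*} (p : ℝ) (E : Finset α) :
    ∑ S ∈ E.powerset, subsetWeight p E S = 1 := by
  simp only [subsetWeight]
  rw [Finset.sum_pow_mul_eq_add_pow]
  simp

/-- An event depending only on `S ∩ T` may be evaluated on random subsets of `T`. -/
theorem sum_subsetWeight_restrict {α : Type*} [DecidableEq α] (p : ℝ) {E T : Finset α} (hT : T ⊆ E)
    (P : Finset α → Prop) (hP : ∀ S ⊆ E, (P S ↔ P (S ∩ T))) :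
    ∑ S ∈ E.powerset, (if P S then subsetWeight p E S else 0)
      = ∑ S ∈ T.powerset, (if P S then subsetWeight p T S else 0) := by
  have h1 : ∑ S ∈ T.powerset, (if P S then subsetWeight p T S else 0)
      = ∑ x ∈ T.powerset ×ˢ (E \ T).powerset,
        (if P x.1 then subsetWeight p T x.1 else 0) * subsetWeight p (E \ T) x.2 := by
    rw [Finset.sum_product]
    refine Finset.sum_congr rfl fun S _ => ?_
    by_cases h : P S <;> simp [h, sum_subsetWeight, ← Finset.mul_sum]
  rw [h1]
  refine Finset.sum_bij' (fun S _ => (S ∩ T, S \ T)) (fun x _ => x.1 ∪ x.2) ?_ ?_ ?_ ?_ ?_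
  · intro S hS
    rw [Finset.mem_powerset] at hS
    simp only [Finset.mem_product, Finset.mem_powerset]
    exact ⟨Finset.inter_subset_right, Finset.sdiff_subset_sdiff hS le_rfl⟩
  · intro x hx
    simp only [Finset.mem_product, Finset.mem_powerset] at hx ⊢
    exact Finset.union_subset (hx.1.trans hT) (hx.2.trans Finset.sdiff_subset)
  · intro S _
    ext a
    simp only [Finset.mem_union, Finset.mem_inter, Finset.mem_sdiff]
    tauto
  · rintro ⟨x, y⟩ hx
    simp only [Finset.mem_product, Finset.mem_powerset] at hx
    have h2 : ∀ a ∈ y, a ∉ T := fun a ha => (Finset.mem_sdiff.1 (hx.2 ha)).2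
    have h3 : ∀ a ∈ x, a ∈ T := fun a ha => hx.1 ha
    ext a
    · simp only [Finset.mem_union, Finset.mem_inter]
      have := h2 a
      have := h3 a
      tauto
    · simp only [Finset.mem_union, Finset.mem_sdiff]
      have := h2 a
      have := h3 a
      tauto
  · intro S hS
    rw [Finset.mem_powerset] at hS
    by_cases h : P S
    · simp only [if_pos h, if_pos ((hP S hS).1 h), subsetWeight]
      have c1 : (S ∩ T).card + (S \ T).card = S.card := Finset.card_inter_add_card_sdiff S T
      have c2 : (E \ T).card + T.card = E.card := Finset.card_sdiff_add_card_eq_card hT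
      have c3 : (S ∩ T).card ≤ T.card := Finset.card_le_card Finset.inter_subset_right
      have c4 : (S \ T).card ≤ (E \ T).card :=
        Finset.card_le_card (Finset.sdiff_subset_sdiff hS le_rfl)
      have c5 : E.card - S.card
          = (T.card - (S ∩ T).card) + ((E \ T).card - (S \ T).card) := by omega
      rw [c5, ← c1, pow_add, pow_add]
      ring
    · simp only [if_neg h, if_neg (fun h' => h ((hP S hS).2 h')), zero_mul]

/-- Change of measure: configurations with density at most `q` are exponentially less likely
under a parameter `p > q` than under `q`. -/
theorem exists_tilting_rate {p q : ℝ} (hq : 0 < q) (hqp : q < p) (hp : p < 1) :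
    ∃ ρ : ℝ, 0 < ρ ∧ ρ < 1 ∧ ∀ m o : ℕ, o ≤ m → (o : ℝ) ≤ q * m →
      p ^ o * (1 - p) ^ (m - o) ≤ ρ ^ m * (q ^ o * (1 - q) ^ (m - o)) := by
  have hp0 : 0 < p := hq.trans hqp
  have hx : 0 < p / q := div_pos hp0 hq
  have hp1 : 0 < 1 - p := by linarith
  have hq1 : 0 < 1 - q := by linarith
  have hy : 0 < (1 - p) / (1 - q) := div_pos hp1 hq1
  set a := Real.log (p / q) with ha
  set b := Real.log ((1 - p) / (1 - q)) with hb
  have ha0 : 0 < a := Real.log_pos ((one_lt_div hq).2 hqp)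
  have hb0 : b < 0 := Real.log_neg hy ((div_lt_one hq1).2 (by linarith))
  have ha1 : a < p / q - 1 :=
    Real.log_lt_sub_one_of_pos hx ((one_lt_div hq).2 hqp).ne'
  have hb1 : b < (1 - p) / (1 - q) - 1 :=
    Real.log_lt_sub_one_of_pos hy ((div_lt_one hq1).2 (by linarith)).ne
  have hea : p = q * Real.exp a := by
    rw [ha, Real.exp_log hx]; field_simp
  have heb : 1 - p = (1 - q) * Real.exp b := by
    rw [hb, Real.exp_log hy]; field_simp
  refine ⟨Real.exp (q * a + (1 - q) * b), Real.exp_pos _, ?_, ?_⟩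
  · rw [Real.exp_lt_one_iff]
    have h1 : q * a < p - q := by
      calc q * a < q * (p / q - 1) := mul_lt_mul_of_pos_left ha1 hq
        _ = p - q := by field_simp
    have h2 : (1 - q) * b < q - p := by
      calc (1 - q) * b < (1 - q) * ((1 - p) / (1 - q) - 1) := mul_lt_mul_of_pos_left hb1 hq1
        _ = q - p := by field_simp; ring
    linarith
  · intro m o hom ho
    have h3 : p ^ o * (1 - p) ^ (m - o)
        = Real.exp (o * a + ((m : ℝ) - o) * b) * (q ^ o * (1 - q) ^ (m - o)) := by
      rw [heb, Real.exp_add, ← Nat.cast_sub hom, Real.exp_nat_mul, Real.exp_nat_mul, mul_pow]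
      nth_rewrite 1 [hea]
      rw [mul_pow]
      ring
    rw [h3, ← Real.exp_nat_mul]
    refine mul_le_mul_of_nonneg_right (Real.exp_le_exp.2 ?_) (by positivity)
    nlinarith [mul_nonneg (sub_nonneg.2 ho) (by linarith : (0 : ℝ) ≤ a - b)]

section Percolation

variable {V : Type*} [Fintype V]

theorem percWeight_eq (G : SimpleGraph V) (p : ℝ) (S : Finset (Sym2 V)) :
    percWeight G p S = subsetWeight p G.edgeFinset S := rfl

theorem percProb_true (G : SimpleGraph V) (p : ℝ) : percProb G p (fun _ => True) = 1 := by
  simp only [percProb, if_true, percWeight_eq]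
  exact sum_subsetWeight p _

theorem percProb_add_not (G : SimpleGraph V) (p : ℝ) (Q : Finset (Sym2 V) → Prop) :
    percProb G p Q + percProb G p (fun S => ¬ Q S) = 1 := by
  rw [← percProb_true G p, percProb, percProb, percProb, ← Finset.sum_add_distrib]
  refine Finset.sum_congr rfl fun S _ => ?_
  by_cases h : Q S <;> simp [h]

theorem percProb_not_forall_le (G : SimpleGraph V) {p : ℝ} (h0 : 0 ≤ p) (h1 : p ≤ 1)
    {ι : Type*} [Fintype ι] (Q R : ι → Finset (Sym2 V) → Prop)
    (h : ∀ S ⊆ G.edgeFinset, ∀ i, ¬ Q i S → R i S) :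
    percProb G p (fun S => ¬ ∀ i, Q i S) ≤ ∑ i, percProb G p (R i) := by
  simp only [percProb]
  rw [Finset.sum_comm]
  refine Finset.sum_le_sum fun S hS => ?_
  have hw : 0 ≤ percWeight G p S := subsetWeight_nonneg h0 h1 _ _
  have hnn : ∀ i ∈ Finset.univ, 0 ≤ (if R i S then percWeight G p S else 0) := by
    intro i _
    split_ifs <;> [exact hw; exact le_rfl]
  split_ifs with hS'
  · exact Finset.sum_nonneg hnn
  · obtain ⟨i, hi⟩ := not_forall.1 hS'
    refine le_trans ?_ (Finset.single_le_sum hnn (Finset.mem_univ i))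
    rw [if_pos (h S (Finset.mem_powerset.1 hS) i hi)]

/-- The edges of `G` meeting `U`. -/
noncomputable def touchingEdges (G : SimpleGraph V) (U : Finset V) : Finset (Sym2 V) :=
  G.edgeFinset.filter fun e => ∃ v ∈ e, v ∈ U

/-- The edges of `G` inside `U`. -/
noncomputable def innerEdges (G : SimpleGraph V) (U : Finset V) : Finset (Sym2 V) :=
  G.edgeFinset.filter fun e => ∀ v ∈ e, v ∈ U

theorem edgesWithin_coe (G : SimpleGraph V) (U : Finset V) :
    edgesWithin G (U : Set V) = (innerEdges G U).card := by
  rw [edgesWithin, ← Set.ncard_coe_finset]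
  congr 1
  ext e
  simp [innerEdges]

theorem degree_mul_card_le {G : SimpleGraph V} {d : ℕ} (hG : isRegular G d) (U : Finset V) :
    d * U.card ≤ (touchingEdges G U).card + (innerEdges G U).card := by
  have hdeg : ∀ v, (G.edgeFinset.filter fun e => v ∈ e).card = d := by
    intro v
    rw [← hG v, ← G.incidenceFinset_eq_filter, G.card_incidenceFinset_eq_degree,
      ← G.card_neighborFinset_eq_degree, ← Set.ncard_coe_finset, G.coe_neighborFinset]
  calc d * U.card = ∑ v ∈ U, (G.edgeFinset.filter fun e => v ∈ e).card := by
        simp [hdeg, mul_comm]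
    _ = ∑ e ∈ G.edgeFinset, (U.filter fun v => v ∈ e).card :=
        Finset.sum_card_bipartiteAbove_eq_sum_card_bipartiteBelow _
    _ ≤ ∑ e ∈ G.edgeFinset, ((if ∃ v ∈ e, v ∈ U then 1 else 0)
          + (if ∀ v ∈ e, v ∈ U then 1 else 0)) := by
        refine Finset.sum_le_sum fun e _ => ?_
        induction e using Sym2.inductionOn with
        | hf x y =>
          have hsub : (U.filter fun v => v ∈ s(x, y)) ⊆ {x, y} := by
            intro v hv
            simpa using (Finset.mem_filter.1 hv).2
          by_cases hx : x ∈ U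
          · by_cases hy : y ∈ U
            · have := (Finset.card_le_card hsub).trans Finset.card_le_two
              simpa [hx, hy] using this
            · have : (U.filter fun v => v ∈ s(x, y)) ⊆ {x} := by
                intro v hv
                have h1 := hsub hv
                have h2 := (Finset.mem_filter.1 hv).1
                simp only [Finset.mem_insert, Finset.mem_singleton] at h1 ⊢
                rcases h1 with rfl | rfl
                · rfl
                · exact absurd h2 hy
              have := Finset.card_le_card this
              simpa [hx, hy] using this
          · by_cases hy : y ∈ U
            · have : (U.filter fun v => v ∈ s(x, y)) ⊆ {y} := by
                intro v hv
                have h1 := hsub hv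
                have h2 := (Finset.mem_filter.1 hv).1
                simp only [Finset.mem_insert, Finset.mem_singleton] at h1 ⊢
                rcases h1 with rfl | rfl
                · exact absurd h2 hx
                · rfl
              have := Finset.card_le_card this
              simpa [hx, hy] using this
            · have : (U.filter fun v => v ∈ s(x, y)) = ∅ := by
                refine Finset.filter_eq_empty_iff.2 fun v hv h => ?_
                rcases Sym2.mem_iff.1 h with rfl | rfl
                · exact hx hv
                · exact hy hv
              rw [this, Finset.card_empty]
              exact Nat.zero_le _
    _ = _ := by
        rw [Finset.sum_add_distrib, Finset.sum_boole, Finset.sum_boole]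
        rfl

/-- The vertices joined to some vertex of `A` by edges of `S`. -/
noncomputable def cluster (A : Finset V) (S : Finset (Sym2 V)) : Finset V :=
  Finset.univ.filter fun u =>
    ∃ a ∈ A, (SimpleGraph.fromEdgeSet (S : Set (Sym2 V))).Reachable a u

theorem mem_cluster {A : Finset V} {S : Finset (Sym2 V)} {u : V} :
    u ∈ cluster A S ↔
      ∃ a ∈ A, (SimpleGraph.fromEdgeSet (S : Set (Sym2 V))).Reachable a u := by
  simp [cluster]

theorem subset_cluster (A : Finset V) (S : Finset (Sym2 V)) : A ⊆ cluster A S :=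
  fun a ha => mem_cluster.2 ⟨a, ha, SimpleGraph.Reachable.refl _⟩

theorem cluster_step {A : Finset V} {S : Finset (Sym2 V)} {x y : V} (hx : x ∈ cluster A S)
    (hxy : s(x, y) ∈ S) : y ∈ cluster A S := by
  obtain ⟨a, ha, hax⟩ := mem_cluster.1 hx
  by_cases hne : x = y
  · exact hne ▸ hx
  · refine mem_cluster.2 ⟨a, ha, hax.trans (SimpleGraph.Adj.reachable ?_)⟩
    simpa [SimpleGraph.fromEdgeSet_adj] using ⟨hxy, hne⟩

/-- A set containing `A` and closed under the edges of `S` contains the cluster. -/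
theorem cluster_subset {A B : Finset V} {S : Finset (Sym2 V)} (hA : A ⊆ B)
    (hB : ∀ x ∈ B, ∀ y, s(x, y) ∈ S → y ∈ B) : cluster A S ⊆ B := by
  intro u hu
  obtain ⟨a, ha, ⟨w⟩⟩ := mem_cluster.1 hu
  have key : ∀ {x y : V} (_ : (SimpleGraph.fromEdgeSet (S : Set (Sym2 V))).Walk x y),
      x ∈ B → y ∈ B := by
    intro x y w
    induction w with
    | nil => exact id
    | cons h _ ih =>
      intro hx
      rw [SimpleGraph.fromEdgeSet_adj] at h
      exact ih (hB _ hx _ (by simpa using h.1))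
  exact key w (hA ha)

theorem card_cluster_le (A : Finset V) (S : Finset (Sym2 V)) {k : ℝ}
    (hk : ∀ a ∈ A, (compCard (SimpleGraph.fromEdgeSet (S : Set (Sym2 V))) a : ℝ) ≤ k) :
    ((cluster A S).card : ℝ) ≤ A.card * k := by
  have h : cluster A S = A.biUnion fun a => Finset.univ.filter fun u =>
      (SimpleGraph.fromEdgeSet (S : Set (Sym2 V))).Reachable a u := by
    ext u
    simp [cluster]
  have h2 : (cluster A S).card
      ≤ ∑ a ∈ A, compCard (SimpleGraph.fromEdgeSet (S : Set (Sym2 V))) a := by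
    rw [h]
    refine Finset.card_biUnion_le.trans (Finset.sum_le_sum fun a _ => ?_)
    rw [compCard, ← Set.ncard_coe_finset]
    simp
  calc ((cluster A S).card : ℝ)
      ≤ ∑ a ∈ A, (compCard (SimpleGraph.fromEdgeSet (S : Set (Sym2 V))) a : ℝ) := by
        exact_mod_cast h2
    _ ≤ ∑ _a ∈ A, k := Finset.sum_le_sum hk
    _ = A.card * k := by simp

theorem cluster_eq_of_inter_eq {G : SimpleGraph V} {A U : Finset V} {S S' : Finset (Sym2 V)}
    (hS : S ⊆ G.edgeFinset) (hS' : S' ⊆ G.edgeFinset)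
    (h : S ∩ touchingEdges G U = S' ∩ touchingEdges G U) (hU : cluster A S = U) :
    cluster A S' = U := by
  have touch : ∀ {x y : V}, x ∈ U → s(x, y) ∈ G.edgeFinset → s(x, y) ∈ touchingEdges G U :=
    fun {x y} hx he => Finset.mem_filter.2 ⟨he, x, Sym2.mem_mk_left x y, hx⟩
  have hle : cluster A S' ⊆ U := by
    refine cluster_subset (hU ▸ subset_cluster A S) fun x hx y hxy => ?_
    have h1 : s(x, y) ∈ S ∩ touchingEdges G U := by
      rw [h]; exact Finset.mem_inter.2 ⟨hxy, touch hx (hS' hxy)⟩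
    rw [← hU] at hx ⊢
    exact cluster_step hx (Finset.mem_inter.1 h1).1
  refine hle.antisymm ?_
  rw [← hU]
  refine cluster_subset (subset_cluster A S') fun x hx y hxy => ?_
  have h1 : s(x, y) ∈ S' ∩ touchingEdges G U := by
    rw [← h]; exact Finset.mem_inter.2 ⟨hxy, touch (hle hx) (hS hxy)⟩
  exact cluster_step hx (Finset.mem_inter.1 h1).1

theorem subset_innerEdges_of_cluster_eq {G : SimpleGraph V} {A U : Finset V}
    {S : Finset (Sym2 V)} (hS : S ⊆ touchingEdges G U) (hU : cluster A S = U) :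
    S ⊆ innerEdges G U := by
  intro e he
  obtain ⟨heG, v, hv, hvU⟩ := Finset.mem_filter.1 (hS he)
  refine Finset.mem_filter.2 ⟨heG, fun w hw => ?_⟩
  by_cases hvw : v = w
  · exact hvw ▸ hvU
  · have : e = s(v, w) := (Sym2.mem_and_mem_iff hvw).1 ⟨hv, hw⟩
    rw [← hU] at hvU ⊢
    exact cluster_step hvU (this ▸ he)

/-- In a locally sparse regular graph, the cluster of `A` is unlikely to be small. -/
theorem percProb_card_cluster_le {G : SimpleGraph V} {d : ℕ} (hG : isRegular G d) {c N : ℝ}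
    (hc : c ≤ (d : ℝ) - 2)
    (hsparse : ∀ U : Finset V, (U.card : ℝ) ≤ N → ((innerEdges G U).card : ℝ) ≤ (1 + c) * U.card)
    {p q ρ : ℝ} (hq0 : 0 ≤ q) (hq1 : q ≤ 1)
    (hq : 1 + c ≤ q * ((d : ℝ) - 1 - c)) (hρ0 : 0 ≤ ρ) (hρ1 : ρ ≤ 1)
    (htilt : ∀ m o : ℕ, o ≤ m → (o : ℝ) ≤ q * m →
      p ^ o * (1 - p) ^ (m - o) ≤ ρ ^ m * (q ^ o * (1 - q) ^ (m - o)))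
    (A : Finset V) :
    percProb G p (fun S => ((cluster A S).card : ℝ) ≤ N) ≤ ρ ^ A.card := by
  have hfix : ∀ U : Finset V, (U.card : ℝ) ≤ N →
      percProb G p (fun S => cluster A S = U)
        ≤ ρ ^ A.card * percProb G q (fun S => cluster A S = U) := by
    intro U hUN
    have hTE : touchingEdges G U ⊆ G.edgeFinset := Finset.filter_subset _ _
    have hloc : ∀ S ⊆ G.edgeFinset,
        (cluster A S = U ↔ cluster A (S ∩ touchingEdges G U) = U) := by
      intro S hS
      have h1 : S ∩ touchingEdges G U = (S ∩ touchingEdges G U) ∩ touchingEdges G U := by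
        rw [Finset.inter_assoc, Finset.inter_self]
      have h2 : S ∩ touchingEdges G U ⊆ G.edgeFinset := Finset.inter_subset_left.trans hS
      exact ⟨cluster_eq_of_inter_eq hS h2 h1, cluster_eq_of_inter_eq h2 hS h1.symm⟩
    simp only [percProb, percWeight_eq]
    rw [sum_subsetWeight_restrict p hTE (fun S => cluster A S = U) hloc,
      sum_subsetWeight_restrict q hTE (fun S => cluster A S = U) hloc, Finset.mul_sum]
    refine Finset.sum_le_sum fun S hS => ?_
    split_ifs with hSU
    · have hST := Finset.mem_powerset.1 hS
      have hin := hsparse U hUN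
      have hdeg : (d : ℝ) * U.card ≤ (touchingEdges G U).card + (innerEdges G U).card := by
        exact_mod_cast degree_mul_card_le hG U
      have hm : ((d : ℝ) - 1 - c) * U.card ≤ (touchingEdges G U).card := by linarith
      have hSI : (S.card : ℝ) ≤ (innerEdges G U).card := by
        exact_mod_cast Finset.card_le_card (subset_innerEdges_of_cluster_eq hST hSU)
      have hU0 : (0 : ℝ) ≤ U.card := Nat.cast_nonneg _
      have ho : (S.card : ℝ) ≤ q * (touchingEdges G U).card := by
        have := mul_le_mul_of_nonneg_left hm hq0
        have := mul_le_mul_of_nonneg_right hq hU0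
        linarith
      have hAU : A.card ≤ U.card := Finset.card_le_card (hSU ▸ subset_cluster A S)
      have hUT : U.card ≤ (touchingEdges G U).card := by
        have : (U.card : ℝ) ≤ (touchingEdges G U).card := by nlinarith
        exact_mod_cast this
      have hw := subsetWeight_nonneg hq0 hq1 (touchingEdges G U) S
      refine (htilt _ _ (Finset.card_le_card hST) ho).trans ?_
      exact mul_le_mul_of_nonneg_right (pow_le_pow_of_le_one hρ0 hρ1 (hAU.trans hUT)) hw
    · simp
  have hdecomp : ∀ r : ℝ, ∀ Q : Finset V → Prop, percProb G r (fun S => Q (cluster A S))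
      = ∑ U : Finset V, if Q U then percProb G r (fun S => cluster A S = U) else 0 := by
    intro r Q
    have : ∀ U : Finset V, (if Q U then percProb G r (fun S => cluster A S = U) else 0)
        = ∑ S ∈ G.edgeFinset.powerset,
          (if cluster A S = U then (if Q U then percWeight G r S else 0) else 0) := by
      intro U
      by_cases h : Q U
      · simp only [if_pos h, percProb]
        exact Finset.sum_congr rfl fun S _ => by congr
      · simp [h]
    rw [Finset.sum_congr rfl fun U _ => this U, Finset.sum_comm, percProb]
    refine Finset.sum_congr rfl fun S _ => ?_
    rw [Finset.sum_ite_eq]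
    simp
  have hnn : ∀ U : Finset V, 0 ≤ percProb G q (fun S => cluster A S = U) := by
    intro U
    refine Finset.sum_nonneg fun S _ => ?_
    split_ifs
    · exact subsetWeight_nonneg hq0 hq1 _ _
    · exact le_rfl
  rw [hdecomp p fun U => (U.card : ℝ) ≤ N]
  calc _ ≤ ∑ U : Finset V, ρ ^ A.card * percProb G q (fun S => cluster A S = U) := by
        refine Finset.sum_le_sum fun U _ => ?_
        split_ifs with h
        · exact hfix U h
        · exact mul_nonneg (pow_nonneg hρ0 _) (hnn U)
    _ = ρ ^ A.card * 1 := by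
        rw [← Finset.mul_sum, ← percProb_true G q, hdecomp q fun _ => True]
        simp
    _ = ρ ^ A.card := mul_one _

/-- The ball of radius `r` around `v`. -/
noncomputable def graphBall (G : SimpleGraph V) (v : V) (r : ℕ) : Finset V :=
  Finset.univ.filter fun u => ∃ w : G.Walk v u, w.length ≤ r

theorem mem_graphBall {G : SimpleGraph V} {v u : V} {r : ℕ} :
    u ∈ graphBall G v r ↔ ∃ w : G.Walk v u, w.length ≤ r := by
  simp [graphBall]

theorem graphBall_mono (G : SimpleGraph V) (v : V) {r s : ℕ} (h : r ≤ s) :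
    graphBall G v r ⊆ graphBall G v s := by
  intro u hu
  obtain ⟨w, hw⟩ := mem_graphBall.1 hu
  exact mem_graphBall.2 ⟨w, hw.trans h⟩

theorem touchingEdges_graphBall_subset (G : SimpleGraph V) (v : V) (r : ℕ) :
    touchingEdges G (graphBall G v r) ⊆ innerEdges G (graphBall G v (r + 1)) := by
  intro e he
  obtain ⟨heG, x, hx, hxB⟩ := Finset.mem_filter.1 he
  refine Finset.mem_filter.2 ⟨heG, fun y hy => ?_⟩
  by_cases hxy : x = y
  · exact hxy ▸ graphBall_mono G v (Nat.le_succ r) hxB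
  · have : e = s(x, y) := (Sym2.mem_and_mem_iff hxy).1 ⟨hx, hy⟩
    have hadj : G.Adj x y := by
      rw [this, SimpleGraph.mem_edgeFinset] at heG
      exact heG
    obtain ⟨w, hw⟩ := mem_graphBall.1 hxB
    refine mem_graphBall.2 ⟨w.concat hadj, ?_⟩
    rw [SimpleGraph.Walk.length_concat]
    omega

/-- In a locally sparse regular graph small balls grow exponentially. -/
theorem pow_le_card_graphBall {G : SimpleGraph V} {d : ℕ} (hG : isRegular G d) {c N g : ℝ}
    (hc0 : 0 ≤ c) (hg0 : 0 ≤ g) (hg : g * (1 + c) ≤ (d : ℝ) - 1 - c)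
    (hsparse : ∀ U : Finset V, (U.card : ℝ) ≤ N → ((innerEdges G U).card : ℝ) ≤ (1 + c) * U.card)
    (v : V) (r : ℕ) (hr : ((graphBall G v r).card : ℝ) ≤ N) :
    g ^ r ≤ (graphBall G v r).card := by
  induction r with
  | zero =>
    have : 0 < (graphBall G v 0).card :=
      Finset.card_pos.2 ⟨v, mem_graphBall.2 ⟨SimpleGraph.Walk.nil, le_rfl⟩⟩
    rw [pow_zero]
    exact_mod_cast this
  | succ r ih =>
    have hle : ((graphBall G v r).card : ℝ) ≤ (graphBall G v (r + 1)).card := by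
      exact_mod_cast Finset.card_le_card (graphBall_mono G v (Nat.le_succ r))
    have hrN := hle.trans hr
    have h1 := ih hrN
    have h2 := hsparse _ hr
    have h3 := hsparse _ hrN
    have h4 : (d : ℝ) * (graphBall G v r).card
        ≤ (touchingEdges G (graphBall G v r)).card + (innerEdges G (graphBall G v r)).card := by
      exact_mod_cast degree_mul_card_le hG _
    have h5 : ((touchingEdges G (graphBall G v r)).card : ℝ)
        ≤ (innerEdges G (graphBall G v (r + 1))).card := by
      exact_mod_cast Finset.card_le_card (touchingEdges_graphBall_subset G v r)
    have h6 : g * (1 + c) * (graphBall G v r).card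
        ≤ (1 + c) * (graphBall G v (r + 1)).card := by
      have := mul_le_mul_of_nonneg_right hg (Nat.cast_nonneg (graphBall G v r).card)
      linarith
    have h7 : g * (graphBall G v r).card ≤ (graphBall G v (r + 1)).card := by
      refine le_of_mul_le_mul_left ?_ (by linarith : (0 : ℝ) < 1 + c)
      linarith
    calc g ^ (r + 1) = g * g ^ r := pow_succ' g r
      _ ≤ g * (graphBall G v r).card := mul_le_mul_of_nonneg_left h1 hg0
      _ ≤ _ := h7

end Percolation

theorem eventually_ceil_mul_le_pow_floor_log (M : ℝ) (hM : 0 < M) :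
    ∀ᶠ L : ℝ in Filter.atTop, (⌈M * L⌉₊ : ℝ) ≤ (1.7 : ℝ) ^ ⌊2 * Real.log L⌋₊ := by
  have hβ : 0 < 2 * Real.log 1.7 - 1 := by
    have h1 : Real.exp 1 < (1.7 : ℝ) ^ 2 := Real.exp_one_lt_d9.trans (by norm_num)
    have h2 := (Real.lt_log_iff_exp_lt (by norm_num)).2 h1
    rw [Real.log_pow] at h2
    push_cast at h2
    linarith
  filter_upwards [Filter.eventually_ge_atTop (1 : ℝ),
    (tendsto_rpow_atTop hβ).eventually_ge_atTop ((M + 1) * 1.7)] with L hL hLβ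
  have hL0 : 0 < L := by linarith
  have hfloor : 2 * Real.log L - 1 ≤ (⌊2 * Real.log L⌋₊ : ℝ) := (Nat.sub_one_lt_floor _).le
  have hpow : (1.7 : ℝ) ^ (2 * Real.log L - 1) = L ^ (2 * Real.log 1.7 - 1) * L / 1.7 := by
    rw [← Real.rpow_add_one hL0.ne', Real.rpow_sub_one (by norm_num), sub_add_cancel,
      Real.rpow_def_of_pos (by norm_num), Real.rpow_def_of_pos hL0]
    ring_nf
  calc (⌈M * L⌉₊ : ℝ) ≤ M * L + 1 := (Nat.ceil_lt_add_one (by positivity)).le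
    _ ≤ (M + 1) * 1.7 * L / 1.7 := by
        rw [mul_right_comm, mul_div_cancel_right₀ _ (by norm_num)]
        linarith
    _ ≤ L ^ (2 * Real.log 1.7 - 1) * L / 1.7 := by gcongr
    _ = (1.7 : ℝ) ^ (2 * Real.log L - 1) := hpow.symm
    _ ≤ (1.7 : ℝ) ^ (⌊2 * Real.log L⌋₊ : ℝ) :=
        Real.rpow_le_rpow_of_exponent_le (by norm_num) hfloor
    _ = _ := Real.rpow_natCast _ _

theorem eventually_ceil_mul_mul_le_rpow (M K : ℝ) (hM : 0 < M) (hK : 0 ≤ K) :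
    ∀ᶠ L : ℝ in Filter.atTop, (⌈M * L⌉₊ : ℝ) * (K * L) ≤ L ^ (4 : ℝ) ∧
      (⌈M * L⌉₊ : ℝ) ≤ L ^ (4 : ℝ) := by
  filter_upwards [Filter.eventually_ge_atTop (1 : ℝ), Filter.eventually_ge_atTop ((M + 1) * K),
    Filter.eventually_ge_atTop (M + 1)] with L hL hLK hLM
  have hL0 : 0 < L := by linarith
  have h4 : L ^ (4 : ℝ) = L ^ 4 := by exact_mod_cast Real.rpow_natCast L 4
  have hceil : (⌈M * L⌉₊ : ℝ) ≤ (M + 1) * L := by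
    have := Nat.ceil_lt_add_one (by positivity : 0 ≤ M * L)
    linarith
  rw [h4]
  constructor
  · calc (⌈M * L⌉₊ : ℝ) * (K * L) ≤ (M + 1) * L * (K * L) := by gcongr
      _ = (M + 1) * K * L ^ 2 := by ring
      _ ≤ L * L ^ 2 := by gcongr
      _ = L ^ 3 := by ring
      _ ≤ L ^ 4 := pow_le_pow_right₀ hL (by norm_num)
  · calc (⌈M * L⌉₊ : ℝ) ≤ (M + 1) * L := hceil
      _ ≤ L * L := by gcongr
      _ = L ^ 2 := by ring
      _ ≤ L ^ 4 := pow_le_pow_right₀ hL (by norm_num)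

/-- With `2 log n / log (1/ρ)` seeds, a failure probability `ρ` per seed beats a union bound. -/
theorem nat_mul_pow_ceil_le {ρ : ℝ} (hρ0 : 0 < ρ) (hρ1 : ρ < 1) {n : ℕ} (hn : 0 < n) :
    (n : ℝ) * ρ ^ ⌈2 / -Real.log ρ * Real.log n⌉₊ ≤ (n : ℝ)⁻¹ := by
  have hn0 : (0 : ℝ) < n := by exact_mod_cast hn
  have hlog : Real.log ρ < 0 := Real.log_neg hρ0 hρ1
  have h : ρ ^ ⌈2 / -Real.log ρ * Real.log n⌉₊ ≤ (n : ℝ)⁻¹ * (n : ℝ)⁻¹ := by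
    rw [← Real.log_le_log_iff (by positivity) (by positivity), Real.log_pow,
      Real.log_mul (by positivity) (by positivity), Real.log_inv]
    have h1 := mul_le_mul_of_nonpos_right
      (Nat.le_ceil (2 / -Real.log ρ * Real.log n)) hlog.le
    have h2 : 2 / -Real.log ρ * Real.log n * Real.log ρ = -2 * Real.log n := by
      field_simp [hlog.ne]
    linarith
  calc (n : ℝ) * ρ ^ ⌈2 / -Real.log ρ * Real.log n⌉₊ ≤ n * ((n : ℝ)⁻¹ * (n : ℝ)⁻¹) := by gcongr
    _ = (n : ℝ)⁻¹ := by field_simp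

/-- Sprinkling setup: `d ≥ 3`, `1 < λ < d-1`, `p = λ/(d-1)`, `δ > 0` with
`λ - δ > 1`, `p₂ = δ/(d-1)`, and `p₁` defined by `(1-p₁)(1-p₂) = 1-p`; `G₁ = G_{p₁}` and
`W = {v : |C_{G₁}(v)| ≥ 5λ log n/(λ-1)²}`. There exist constants `c > 0`, `δ > 0` and `C > 3`
such that for every `ε > 0` there is `n₀`: for every `n ≥ n₀` and every `d`-regular graph `G`
on `n` vertices satisfying (P2), with probability at least `1-ε` every vertex `v` satisfies
`dist_G(v, W) ≤ 2 log log n`. -/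
theorem statement_11 (d : ℕ) (hd : 3 ≤ d) (lam : ℝ) (hlam₁ : 1 < lam)
    (hlam₂ : lam < (d : ℝ) - 1) (p : ℝ) (hp : p = lam / ((d : ℝ) - 1)) :
    ∃ c > (0 : ℝ), ∃ δ : ℝ, (0 < δ ∧ 1 < lam - δ) ∧ ∃ C > (3 : ℝ),
    ∀ p₁ p₂ : ℝ, p₂ = δ / ((d : ℝ) - 1) → (1 - p₁) * (1 - p₂) = 1 - p →
    ∀ ε > (0 : ℝ), ∃ n₀ : ℕ, ∀ n : ℕ, n₀ ≤ n →
    ∀ G : SimpleGraph (Fin n), isRegular G d →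
    (∀ U : Set (Fin n), (U.ncard : ℝ) ≤ Real.log n ^ C →
      (edgesWithin G U : ℝ) ≤ (1 + c) * U.ncard) →
    1 - ε ≤ percProb G p₁ (fun S₁ =>
      ∀ v : Fin n, ∃ w : Fin n,
        5 * lam * Real.log n / (lam - 1) ^ 2
            ≤ (compCard (SimpleGraph.fromEdgeSet (↑S₁ : Set (Sym2 (Fin n)))) w : ℝ) ∧
        ∃ wk : G.Walk v w, (wk.length : ℝ) ≤ 2 * Real.log (Real.log n)) := by
  have hD : (2 : ℝ) ≤ (d : ℝ) - 1 := by
    have : (3 : ℝ) ≤ d := by exact_mod_cast hd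
    linarith
  have hD0 : (0 : ℝ) < (d : ℝ) - 1 := by linarith
  set D : ℝ := (d : ℝ) - 1 with hDdef
  set a : ℝ := (lam + 1) / 2 with ha
  have ha1 : 1 < a := by rw [ha]; linarith
  obtain ⟨c, hc0, hc10, hcq⟩ : ∃ c : ℝ, 0 < c ∧ c ≤ 1 / 10 ∧ c * (D + a) < (a - 1) * D := by
    have hpos : 0 < (a - 1) * D / (2 * (D + a)) := by
      have : 0 < a - 1 := by linarith
      positivity
    refine ⟨min (1 / 10) ((a - 1) * D / (2 * (D + a))), lt_min (by norm_num) hpos,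
      min_le_left _ _, ?_⟩
    have hDa : 0 < D + a := by linarith
    calc min (1 / 10) ((a - 1) * D / (2 * (D + a))) * (D + a)
        ≤ (a - 1) * D / (2 * (D + a)) * (D + a) :=
          mul_le_mul_of_nonneg_right (min_le_right _ _) hDa.le
      _ = (a - 1) * D / 2 := by field_simp
      _ < (a - 1) * D := half_lt_self (mul_pos (by linarith) hD0)
  refine ⟨c, hc0, lam - a, ⟨by rw [ha]; linarith, by linarith⟩, 4, by norm_num, ?_⟩
  intro p₁ p₂ hp₂ hp₁ ε hε
  have hp1 : p < 1 := by rw [hp, div_lt_one hD0]; exact hlam₂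
  have hp₂0 : 0 ≤ p₂ := by
    rw [hp₂]
    exact div_nonneg (by rw [ha]; linarith) hD0.le
  have hpp₂ : p - p₂ = a / D := by rw [hp, hp₂]; ring
  have hadiv : 0 < a / D := by positivity
  have hp₂1 : p₂ < 1 := by linarith
  have hp₁1 : p₁ < 1 := by
    by_contra hcon
    nlinarith [mul_nonneg (by linarith : (0 : ℝ) ≤ p₁ - 1) (by linarith : (0 : ℝ) ≤ 1 - p₂)]
  have hp₁a : a / D ≤ p₁ := by nlinarith
  have hDc : 0 < D - c := by linarith
  set q : ℝ := (1 + c) / (D - c) with hqdef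
  have hq0 : 0 < q := by positivity
  have hqp : q < p₁ := by
    refine lt_of_lt_of_le ?_ hp₁a
    rw [hqdef, div_lt_div_iff₀ hDc hD0]
    linarith
  obtain ⟨ρ, hρ0, hρ1, htilt⟩ := exists_tilting_rate hq0 hqp hp₁1
  have hM : 0 < 2 / -Real.log ρ := div_pos two_pos (neg_pos.2 (Real.log_neg hρ0 hρ1))
  set M : ℝ := 2 / -Real.log ρ with hMdef
  have hK : 0 ≤ 5 * lam / (lam - 1) ^ 2 := by positivity
  have hlogtop : Filter.Tendsto (fun n : ℕ => Real.log n) Filter.atTop Filter.atTop :=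
    Real.tendsto_log_atTop.comp tendsto_natCast_atTop_atTop
  have hev := (hlogtop.eventually (eventually_ceil_mul_le_pow_floor_log M hM)).and
    ((hlogtop.eventually (eventually_ceil_mul_mul_le_rpow M _ hM hK)).and
    ((hlogtop.eventually_ge_atTop 1).and ((Filter.eventually_gt_atTop 0).and
    (tendsto_natCast_atTop_atTop.eventually_ge_atTop (ε⁻¹ : ℝ)))))
  obtain ⟨n₀, hn₀⟩ := Filter.eventually_atTop.1 hev
  refine ⟨n₀, fun n hn G hG hP2 => ?_⟩
  obtain ⟨hball, ⟨hsize, hsize'⟩, hlog1, hnpos, hnε⟩ := hn₀ n hn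
  have hsparse : ∀ U : Finset (Fin n), (U.card : ℝ) ≤ Real.log n ^ (4 : ℝ) →
      ((innerEdges G U).card : ℝ) ≤ (1 + c) * U.card := by
    intro U hU
    have := hP2 U (by rwa [Set.ncard_coe_finset])
    rwa [edgesWithin_coe, Set.ncard_coe_finset] at this
  have hseeds : ∀ v : Fin n, ∃ A ⊆ graphBall G v ⌊2 * Real.log (Real.log n)⌋₊,
      A.card = ⌈M * Real.log n⌉₊ := by
    intro v
    refine Finset.exists_subset_card_eq ?_
    by_contra! hlt
    have hlt' : ((graphBall G v ⌊2 * Real.log (Real.log n)⌋₊).card : ℝ)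
        < ⌈M * Real.log n⌉₊ := by exact_mod_cast hlt
    have := pow_le_card_graphBall hG hc0.le (by norm_num : (0 : ℝ) ≤ 1.7) (by linarith)
      hsparse v _ (hlt'.le.trans hsize')
    linarith
  choose A hAball hAcard using hseeds
  have hbad := percProb_not_forall_le G (p := p₁) (by linarith) hp₁1.le
    (fun (v : Fin n) S₁ => ∃ w : Fin n,
        5 * lam * Real.log n / (lam - 1) ^ 2
            ≤ (compCard (SimpleGraph.fromEdgeSet (↑S₁ : Set (Sym2 (Fin n)))) w : ℝ) ∧
        ∃ wk : G.Walk v w, (wk.length : ℝ) ≤ 2 * Real.log (Real.log n))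
    (fun v S₁ => ((cluster (A v) S₁).card : ℝ) ≤ Real.log n ^ (4 : ℝ)) (by
      intro S _ v hv
      refine le_trans ?_ hsize
      rw [← hAcard v]
      refine card_cluster_le (A v) S fun w hw => ?_
      by_contra! hcon
      refine hv ⟨w, le_of_eq_of_le (by ring) hcon.le, ?_⟩
      obtain ⟨wk, hwk⟩ := mem_graphBall.1 (hAball v hw)
      refine ⟨wk, le_trans (by exact_mod_cast hwk) (Nat.floor_le ?_)⟩
      exact mul_nonneg two_pos.le (Real.log_nonneg hlog1))
  have hone : ∀ v : Fin n,
      percProb G p₁ (fun S₁ => ((cluster (A v) S₁).card : ℝ) ≤ Real.log n ^ (4 : ℝ))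
        ≤ ρ ^ ⌈M * Real.log n⌉₊ := by
    intro v
    rw [← hAcard v]
    refine percProb_card_cluster_le hG (c := c) (by linarith) hsparse hq0.le (by linarith) ?_
      hρ0.le hρ1.le htilt (A v)
    rw [← hDdef, hqdef, div_mul_cancel₀ _ hDc.ne']
  have hsum := hbad.trans (Finset.sum_le_sum fun v _ => hone v)
  rw [Finset.sum_const, Finset.card_univ, Fintype.card_fin, nsmul_eq_mul] at hsum
  have hfin := hsum.trans (nat_mul_pow_ceil_le hρ0 hρ1 hnpos)
  have hinv : (n : ℝ)⁻¹ ≤ ε := inv_le_of_inv_le₀ hε hnε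
  have htot := percProb_add_not G p₁ (fun S₁ => ∀ v : Fin n, ∃ w : Fin n,
        5 * lam * Real.log n / (lam - 1) ^ 2
            ≤ (compCard (SimpleGraph.fromEdgeSet (↑S₁ : Set (Sym2 (Fin n)))) w : ℝ) ∧
        ∃ wk : G.Walk v w, (wk.length : ℝ) ≤ 2 * Real.log (Real.log n))
  linarith
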